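/- Let Λ = ℤ^n B be a lattice in ℝ^n with B ∈ GL_n(ℝ), and define the Laplacian of a bounded f : Λ → ℝ by Δ_Λ f(x) = (1/2n) Σ_{j=1}^n (f(x+b_j)+f(x−b_j)−2f(x)), where b_j is the j-th row of B. Let u_0 : Λ → ℝ be bounded. Then the heat equation ∂_t u(x,t) = Δ_Λ u(x,t) on Λ × ℝ_{≥0} with u(x,0) = u_0(x) has a unique bounded solution u : Λ × ℝ_{≥0} → ℝ, differentiable in t ∈ ℝ_{>0} and continuous in t ∈ ℝ_{≥0}, given by u(x,t) = Σ_{y∈Λ} u_0(x−y) K_{Λ,t}(y), where K_{Λ,t}(y) = e^{−t} ∏_{j=1}^n I_{(yB^{-1})_j}(t/n) and (yB^{-1})_j ∈ ℤ denotes the j-th component of yB^{-1}. -/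

import Mathlib

open scoped Real
open Complex Matrix

/-- The modified Bessel function of the first kind with integer order,
`I_x(t) = (1/π) ∫₀^π e^{t cos θ} cos(xθ) dθ`. -/
noncomputable def besselI (x : ℝ) (t : ℂ) : ℂ :=
  (Real.pi : ℂ)⁻¹ * ∫ θ in (0:ℝ)..Real.pi, Complex.exp (t * Real.cos θ) * (Real.cos (x * θ) : ℂ)

/-- `u` solves the semidiscrete heat equation `∂_t u = Δ_Λ u` on `Λ × ℝ_{≥0}` with
initial condition `u0`, for the lattice `Λ = ℤ^n B` regarded as a `2n`-regular graph
(`x ∈ Λ` is adjacent to `x ± b_j`); in the coordinates `Λ ≅ ℤ^n`, `k ↦ kB`,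
`Δ_Λ f(x) = (1/2n) Σ_j (f(x+b_j)+f(x−b_j)−2f(x))` becomes
`(1/2n) Σ_j (f(k+e_j)+f(k−e_j)−2f(k))`. We require `u` to be continuous in
`t ∈ ℝ_{≥0}` and differentiable in `t ∈ ℝ_{>0}`. -/
def IsLatticeHeatSolution (n : ℕ) (u0 : (Fin n → ℤ) → ℝ)
    (u : (Fin n → ℤ) → ℝ → ℝ) : Prop :=
  (∀ x, ContinuousOn (u x) (Set.Ici 0)) ∧
  (∀ x t, 0 ≤ t → HasDerivWithinAt (u x)
      ((1 / (2 * (n : ℝ))) *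
        ∑ j, (u (x + Pi.single j 1) t + u (x - Pi.single j 1) t - 2 * u x t))
      (Set.Ici 0) t) ∧
  (∀ x t, 0 < t → HasDerivAt (u x)
      ((1 / (2 * (n : ℝ))) *
        ∑ j, (u (x + Pi.single j 1) t + u (x - Pi.single j 1) t - 2 * u x t)) t) ∧
  (∀ x, u x 0 = u0 x)

/-- `u` is bounded on `Λ × ℝ_{≥0}`. -/
def IsBoundedSol (n : ℕ) (u : (Fin n → ℤ) → ℝ → ℝ) : Prop :=
  ∃ M : ℝ, ∀ x t, 0 ≤ t → |u x t| ≤ M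

open scoped Topology

/-- The discrete Laplacian `(1/2n) Σ_j (f(x+e_j)+f(x-e_j)-2f(x))` on `ℤ^n`. -/
noncomputable def latticeLaplacian (n : ℕ) (f : (Fin n → ℤ) → ℝ) (x : Fin n → ℤ) : ℝ :=
  (1 / (2 * (n : ℝ))) * ∑ j, (f (x + Pi.single j 1) + f (x - Pi.single j 1) - 2 * f x)

theorem latticeLaplacian_eq {n : ℕ} (hn : 0 < n) (f : (Fin n → ℤ) → ℝ) (x : Fin n → ℤ) :
    latticeLaplacian n f x =
      (1 / (2 * (n : ℝ))) * ∑ j, (f (x + Pi.single j 1) + f (x - Pi.single j 1)) - f x := by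
  have : (n : ℝ) ≠ 0 := by positivity
  simp only [latticeLaplacian, Finset.sum_sub_distrib, Finset.sum_const, Finset.card_univ,
    Fintype.card_fin, nsmul_eq_mul]
  field_simp

theorem abs_latticeLaplacian_le {n : ℕ} (hn : 0 < n) {f : (Fin n → ℤ) → ℝ} {C : ℝ}
    (hf : ∀ x, |f x| ≤ C) (x : Fin n → ℤ) : |latticeLaplacian n f x| ≤ 2 * C := by
  have hn' : (0 : ℝ) < n := by positivity
  have hsum : |∑ j : Fin n, (f (x + Pi.single j 1) + f (x - Pi.single j 1) - 2 * f x)|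
      ≤ ∑ _j : Fin n, 4 * C := by
    refine (Finset.abs_sum_le_sum_abs _ _).trans (Finset.sum_le_sum fun j _ => ?_)
    have h₁ := abs_le.1 (hf (x + Pi.single j 1))
    have h₂ := abs_le.1 (hf (x - Pi.single j 1))
    have h₃ := abs_le.1 (hf x)
    exact abs_le.2 ⟨by linarith, by linarith⟩
  rw [latticeLaplacian, abs_mul, abs_of_pos (by positivity)]
  calc _ ≤ (1 / (2 * (n : ℝ))) * ∑ _j : Fin n, 4 * C := by gcongr
    _ = 2 * C := by
      simp only [Finset.sum_const, Finset.card_univ, Fintype.card_fin, nsmul_eq_mul]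
      field_simp
      ring

theorem isLatticeHeatSolution_of_hasDerivAt {n : ℕ} {u0 : (Fin n → ℤ) → ℝ}
    {u : (Fin n → ℤ) → ℝ → ℝ}
    (hu : ∀ x t, HasDerivAt (u x) (latticeLaplacian n (fun y => u y t) x) t)
    (h0 : ∀ x, u x 0 = u0 x) : IsLatticeHeatSolution n u0 u :=
  ⟨fun x t _ => (hu x t).continuousAt.continuousWithinAt,
    fun x t _ => (hu x t).hasDerivWithinAt, fun x t _ => hu x t, h0⟩

theorem latticeLaplacian_sub (n : ℕ) (f g : (Fin n → ℤ) → ℝ) (x : Fin n → ℤ) :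
    latticeLaplacian n (fun y => f y - g y) x =
      latticeLaplacian n f x - latticeLaplacian n g x := by
  simp only [latticeLaplacian]
  rw [← mul_sub, ← Finset.sum_sub_distrib]
  congr 1
  exact Finset.sum_congr rfl fun j _ => by ring

/-- Bounded solutions of the lattice heat equation are determined by their initial values. -/
theorem IsLatticeHeatSolution.unique {n : ℕ} (hn : 0 < n) {u0 : (Fin n → ℤ) → ℝ}
    {u v : (Fin n → ℤ) → ℝ → ℝ} (hub : IsBoundedSol n u) (hu : IsLatticeHeatSolution n u0 u)
    (hvb : IsBoundedSol n v) (hv : IsLatticeHeatSolution n u0 v) (x : Fin n → ℤ) {t : ℝ}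
    (ht : 0 ≤ t) : u x t = v x t := by
  obtain ⟨M₁, hM₁⟩ := hub
  obtain ⟨M₂, hM₂⟩ := hvb
  have key : ∀ (m : ℕ) (x : Fin n → ℤ) (t : ℝ), 0 ≤ t →
      |u x t - v x t| ≤ (M₁ + M₂) * ((2 * t) ^ m / m.factorial) := by
    intro m
    induction m with
    | zero =>
      intro x t ht
      simpa using (abs_sub _ _).trans (add_le_add (hM₁ x t ht) (hM₂ x t ht))
    | succ m ih =>
      intro x t ht
      refine image_norm_le_of_norm_deriv_right_le_deriv_boundary (f := fun s => u x s - v x s)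
        (f' := fun s => latticeLaplacian n (fun y => u y s - v y s) x)
        (B := fun s => (M₁ + M₂) * ((2 * s) ^ (m + 1) / (m + 1).factorial))
        (B' := fun s => 2 * ((M₁ + M₂) * ((2 * s) ^ m / m.factorial)))
        (a := 0) (b := t) ?_ ?_ ?_ ?_ ?_ ⟨ht, le_rfl⟩
      · exact ((hu.1 x).sub (hv.1 x)).mono Set.Icc_subset_Ici_self
      · intro s hs
        rw [latticeLaplacian_sub]
        exact ((hu.2.1 x s hs.1).sub (hv.2.1 x s hs.1)).mono (Set.Ici_subset_Ici.2 hs.1)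
      · simp [hu.2.2.2 x, hv.2.2.2 x]
      · intro s
        have h := ((((hasDerivAt_id s).const_mul 2).pow (m + 1)).div_const
          ((m + 1).factorial : ℝ)).const_mul (M₁ + M₂)
        convert! h using 1
        simp only [Nat.factorial_succ, Nat.cast_mul, id, Nat.add_sub_cancel, Nat.cast_add,
          Nat.cast_one]
        have : (m.factorial : ℝ) ≠ 0 := by positivity
        have : (m : ℝ) + 1 ≠ 0 := by positivity
        field_simp
      · intro s hs
        exact abs_latticeLaplacian_le hn (fun y => ih y s hs.1) x
  have hlim : Filter.Tendsto (fun m : ℕ => (M₁ + M₂) * ((2 * t) ^ m / m.factorial))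
      Filter.atTop (𝓝 0) := by
    simpa using (FloorSemiring.tendsto_pow_div_factorial_atTop (2 * t)).const_mul (M₁ + M₂)
  have h := ge_of_tendsto' hlim fun m => key m x t ht
  exact sub_eq_zero.1 (abs_nonpos_iff.1 h)

section Shift

variable {G : Type*}

theorem lp.summable_norm_one (f : lp (fun _ : G => ℝ) 1) : Summable fun x => ‖f x‖ := by
  simpa using (lp.memℓp f).summable (by simp)

theorem lp.norm_one_eq_tsum (f : lp (fun _ : G => ℝ) 1) : ‖f‖ = ∑' x, ‖f x‖ := by
  simpa using lp.norm_eq_tsum_rpow (by simp) f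

variable [AddGroup G]

/-- Translation by `a` as a bounded operator on `ℓ¹`. -/
noncomputable def lpShift (a : G) : lp (fun _ : G => ℝ) 1 →L[ℝ] lp (fun _ : G => ℝ) 1 :=
  LinearMap.mkContinuous
    { toFun := fun f => ⟨fun x => f (x + a), memℓp_gen (by
        simpa [Function.comp_def] using
          (Equiv.addRight a).summable_iff.2 (lp.summable_norm_one f))⟩
      map_add' := fun _ _ => rfl
      map_smul' := fun _ _ => rfl } 1 fun f => by
    rw [one_mul, lp.norm_one_eq_tsum, lp.norm_one_eq_tsum]
    exact ((Equiv.addRight a).tsum_eq fun x => ‖f x‖).le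

@[simp]
theorem lpShift_apply (a : G) (f : lp (fun _ : G => ℝ) 1) (x : G) : lpShift a f x = f (x + a) :=
  rfl

theorem norm_lpShift_le (a : G) : ‖lpShift a‖ ≤ 1 :=
  LinearMap.mkContinuous_norm_le _ zero_le_one _

/-- Convolution of an `ℓ¹` function with a bounded function, evaluated at `k`. -/
noncomputable def lpConv (u0 : G → ℝ) (M : ℝ) (hM : ∀ k, |u0 k| ≤ M) (k : G) :
    lp (fun _ : G => ℝ) 1 →L[ℝ] ℝ :=
  have hle (f : lp (fun _ : G => ℝ) 1) (l : G) : ‖u0 (k - l) * f l‖ ≤ M * ‖f l‖ := by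
    rw [norm_mul]
    exact mul_le_mul_of_nonneg_right (hM _) (norm_nonneg _)
  have hs (f : lp (fun _ : G => ℝ) 1) : Summable fun l => u0 (k - l) * f l :=
    Summable.of_norm_bounded ((lp.summable_norm_one f).mul_left M) (hle f)
  LinearMap.mkContinuous
    { toFun := fun f => ∑' l, u0 (k - l) * f l
      map_add' := fun f g => by
        rw [← (hs f).tsum_add (hs g)]
        exact tsum_congr fun l => mul_add _ _ _
      map_smul' := fun c f => by
        rw [RingHom.id_apply, smul_eq_mul, ← tsum_mul_left]
        exact tsum_congr fun l => mul_left_comm _ _ _ } M fun f => by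
    rw [lp.norm_one_eq_tsum, ← tsum_mul_left]
    exact tsum_of_norm_bounded ((lp.summable_norm_one f).mul_left M).hasSum (hle f)

theorem lpConv_apply (u0 : G → ℝ) (M : ℝ) (hM : ∀ k, |u0 k| ≤ M) (k : G)
    (f : lp (fun _ : G => ℝ) 1) : lpConv u0 M hM k f = ∑' l, u0 (k - l) * f l :=
  rfl

theorem abs_lpConv_le (u0 : G → ℝ) (M : ℝ) (hM : ∀ k, |u0 k| ≤ M) (k : G)
    (f : lp (fun _ : G => ℝ) 1) : |lpConv u0 M hM k f| ≤ M * ‖f‖ := by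
  refine (lpConv u0 M hM k).le_of_opNorm_le ?_ f
  rw [lpConv]
  exact LinearMap.mkContinuous_norm_le _ ((abs_nonneg _).trans (hM k)) _

theorem lpConv_shift (u0 : G → ℝ) (M : ℝ) (hM : ∀ k, |u0 k| ≤ M) (k a : G)
    (f : lp (fun _ : G => ℝ) 1) :
    lpConv u0 M hM k (lpShift a f) = lpConv u0 M hM (k + a) f := by
  simp only [lpConv_apply, lpShift_apply]
  rw [← (Equiv.addRight a).tsum_eq fun l => u0 (k + a - l) * f l]
  exact tsum_congr fun l => by simp

end Shift

/-- The transition operator of the simple random walk on `ℤ^n`, acting on `ℓ¹`. -/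
noncomputable def walkOp (n : ℕ) :
    lp (fun _ : Fin n → ℤ => ℝ) 1 →L[ℝ] lp (fun _ : Fin n → ℤ => ℝ) 1 :=
  (1 / (2 * (n : ℝ))) • ∑ j : Fin n, (lpShift (Pi.single j 1) + lpShift (-Pi.single j 1))

theorem norm_walkOp_le (n : ℕ) : ‖walkOp n‖ ≤ 1 := by
  have hsum : ‖∑ j : Fin n, (lpShift (Pi.single j (1 : ℤ) : Fin n → ℤ) + lpShift (-Pi.single j 1))‖
      ≤ ∑ _j : Fin n, (1 + 1 : ℝ) :=
    norm_sum_le_of_le _ fun j _ => norm_add_le_of_le (norm_lpShift_le _) (norm_lpShift_le _)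
  rw [walkOp, norm_smul, Real.norm_of_nonneg (by positivity)]
  refine (mul_le_mul_of_nonneg_left hsum (by positivity)).trans ?_
  rcases Nat.eq_zero_or_pos n with rfl | hn
  · simp
  · have : (n : ℝ) ≠ 0 := by positivity
    simp only [Finset.sum_const, Finset.card_univ, Fintype.card_fin, nsmul_eq_mul]
    apply le_of_eq
    field_simp
    norm_num

/-- The heat flow in `ℓ¹(ℤ^n)` started at the point mass at the origin. -/
noncomputable def heatFlow (n : ℕ) (t : ℝ) : lp (fun _ : Fin n → ℤ => ℝ) 1 :=
  Real.exp (-t) • NormedSpace.exp (t • walkOp n) (lp.single 1 0 1)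

theorem heatFlow_zero (n : ℕ) : heatFlow n 0 = lp.single 1 0 1 := by
  simp [heatFlow, NormedSpace.exp_zero]

theorem hasDerivAt_exp_walkOp (n : ℕ) (f : lp (fun _ : Fin n → ℤ => ℝ) 1) (t : ℝ) :
    HasDerivAt (fun s : ℝ => NormedSpace.exp (s • walkOp n) f)
      (walkOp n (NormedSpace.exp (t • walkOp n) f)) t :=
  (ContinuousLinearMap.apply ℝ (lp (fun _ : Fin n → ℤ => ℝ) 1) f).hasFDerivAt.comp_hasDerivAt t
    (hasDerivAt_exp_smul_const' (walkOp n) t)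

theorem hasDerivAt_heatFlow (n : ℕ) (t : ℝ) :
    HasDerivAt (heatFlow n) (walkOp n (heatFlow n t) - heatFlow n t) t := by
  have h := (hasDerivAt_neg t).exp.smul (hasDerivAt_exp_walkOp n (lp.single 1 0 1) t)
  refine h.congr_deriv ?_
  simp [heatFlow, sub_eq_add_neg]

theorem norm_heatFlow_le (n : ℕ) {t : ℝ} (ht : 0 ≤ t) : ‖heatFlow n t‖ ≤ 1 := by
  have h := norm_le_gronwallBound_of_norm_deriv_right_le
    (f := fun s : ℝ => NormedSpace.exp (s • walkOp n) (lp.single 1 0 1)) (δ := 1) (K := 1)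
    (ε := 0) (a := 0) (b := t)
    (fun s _ => (hasDerivAt_exp_walkOp n _ s).continuousAt.continuousWithinAt)
    (fun s _ => (hasDerivAt_exp_walkOp n _ s).hasDerivWithinAt)
    (by simp [NormedSpace.exp_zero, lp.norm_single])
    (fun s _ => by simpa using (walkOp n).le_of_opNorm_le (norm_walkOp_le n) _) t ⟨ht, le_rfl⟩
  rw [gronwallBound_ε0, one_mul, one_mul, sub_zero] at h
  rw [heatFlow, norm_smul, Real.norm_of_nonneg (Real.exp_pos _).le, Real.exp_neg]
  exact inv_mul_le_one_of_le₀ h (Real.exp_pos _).le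

theorem lpConv_walkOp_sub {n : ℕ} (hn : 0 < n) (u0 : (Fin n → ℤ) → ℝ) (M : ℝ)
    (hM : ∀ k, |u0 k| ≤ M) (k : Fin n → ℤ) (f : lp (fun _ : Fin n → ℤ => ℝ) 1) :
    lpConv u0 M hM k (walkOp n f - f) =
      latticeLaplacian n (fun y => lpConv u0 M hM y f) k := by
  rw [latticeLaplacian_eq hn, map_sub, walkOp]
  simp [lpConv_shift, sub_eq_add_neg]

theorem lpConv_heatFlow_isLatticeHeatSolution {n : ℕ} (hn : 0 < n) (u0 : (Fin n → ℤ) → ℝ) (M : ℝ)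
    (hM : ∀ k, |u0 k| ≤ M) :
    IsLatticeHeatSolution n u0 fun k t => lpConv u0 M hM k (heatFlow n t) := by
  refine isLatticeHeatSolution_of_hasDerivAt (fun k t => ?_) fun k => ?_
  · rw [← lpConv_walkOp_sub hn]
    exact (lpConv u0 M hM k).hasFDerivAt.comp_hasDerivAt t (hasDerivAt_heatFlow n t)
  · rw [heatFlow_zero, lpConv_apply, tsum_eq_single 0]
    · simp
    · intro l hl
      simp [Pi.single_eq_of_ne hl]

theorem lpConv_heatFlow_isBoundedSol (n : ℕ) (u0 : (Fin n → ℤ) → ℝ) (M : ℝ)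
    (hM : ∀ k, |u0 k| ≤ M) : IsBoundedSol n fun k t => lpConv u0 M hM k (heatFlow n t) :=
  ⟨M, fun k _ ht => (abs_lpConv_le u0 M hM k _).trans
    (mul_le_of_le_one_right ((abs_nonneg _).trans (hM k)) (norm_heatFlow_le n ht))⟩

/-- The real-valued modified Bessel function of integer order. -/
noncomputable def realBesselI (k : ℤ) (t : ℝ) : ℝ :=
  π⁻¹ * ∫ θ in (0 : ℝ)..π, Real.exp (t * Real.cos θ) * Real.cos (k * θ)

theorem besselI_intCast (k : ℤ) (t : ℝ) : besselI k t = realBesselI k t := by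
  simp only [besselI, realBesselI]
  push_cast
  rw [← intervalIntegral.integral_ofReal]
  push_cast
  rfl

theorem realBesselI_zero (k : ℤ) : realBesselI k 0 = if k = 0 then 1 else 0 := by
  simp only [realBesselI, zero_mul, Real.exp_zero, one_mul]
  split_ifs with hk
  · simp [hk, Real.pi_ne_zero]
  · have hk' : (k : ℝ) ≠ 0 := by exact_mod_cast hk
    rw [intervalIntegral.integral_comp_mul_left _ hk']
    simp [Real.sin_int_mul_pi]

theorem abs_realBesselI_le (k : ℤ) {t : ℝ} (ht : 0 ≤ t) : |realBesselI k t| ≤ Real.exp t := by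
  have h := intervalIntegral.norm_integral_le_of_norm_le_const (a := 0) (b := π)
    (f := fun θ => Real.exp (t * Real.cos θ) * Real.cos (k * θ)) (C := Real.exp t)
    fun θ _ => by
      rw [norm_mul, Real.norm_of_nonneg (Real.exp_pos _).le]
      refine (mul_le_of_le_one_right (Real.exp_pos _).le (Real.abs_cos_le_one _)).trans ?_
      exact Real.exp_le_exp.2 (mul_le_of_le_one_right ht (Real.cos_le_one θ))
  rw [sub_zero, abs_of_pos Real.pi_pos, Real.norm_eq_abs] at h
  rw [realBesselI, abs_mul, abs_of_pos (inv_pos.2 Real.pi_pos), inv_mul_le_iff₀ Real.pi_pos]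
  linarith

theorem hasDerivAt_realBesselI (k : ℤ) (t : ℝ) :
    HasDerivAt (realBesselI k) ((realBesselI (k + 1) t + realBesselI (k - 1) t) / 2) t := by
  have h := (intervalIntegral.hasDerivAt_integral_of_dominated_loc_of_deriv_le
    (μ := MeasureTheory.volume) (a := 0) (b := π)
    (F := fun s θ => Real.exp (s * Real.cos θ) * Real.cos (k * θ))
    (F' := fun s θ => Real.exp (s * Real.cos θ) * Real.cos θ * Real.cos (k * θ))
    (x₀ := t) (s := Metric.ball t 1) (bound := fun _ => Real.exp (|t| + 1))
    (Metric.ball_mem_nhds t one_pos)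
    (Filter.Eventually.of_forall fun s => by fun_prop)
    (Continuous.intervalIntegrable (by fun_prop) _ _)
    (by fun_prop)
    (Filter.Eventually.of_forall fun θ _ s hs => ?_)
    (by simp)
    (Filter.Eventually.of_forall fun θ _ s _ => ?_)).2
  · refine (h.const_mul π⁻¹).congr_deriv ?_
    rw [realBesselI, realBesselI, ← mul_add, ← intervalIntegral.integral_add
      (Continuous.intervalIntegrable (by fun_prop) _ _)
      (Continuous.intervalIntegrable (by fun_prop) _ _), mul_div_assoc,
      ← intervalIntegral.integral_div]
    congr 2
    ext θ
    push_cast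
    rw [add_mul, sub_mul, one_mul, Real.cos_add, Real.cos_sub]
    ring
  · rw [norm_mul, norm_mul, Real.norm_of_nonneg (Real.exp_pos _).le]
    refine (mul_le_of_le_one_right (by positivity) (Real.abs_cos_le_one _)).trans ?_
    refine (mul_le_of_le_one_right (by positivity) (Real.abs_cos_le_one _)).trans ?_
    refine Real.exp_le_exp.2 ((le_abs_self _).trans ?_)
    rw [abs_mul]
    refine (mul_le_of_le_one_right (abs_nonneg _) (Real.abs_cos_le_one _)).trans ?_
    have h₁ : |s - t| < 1 := by simpa [Real.dist_eq] using hs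
    linarith [abs_sub_abs_le_abs_sub s t]
  · simpa using (((hasDerivAt_id s).mul_const (Real.cos θ)).exp.mul_const (Real.cos (k * θ)))

/-- The heat kernel `e^{-t} ∏_j I_{k_j}(t/n)` on `ℤ^n`. -/
noncomputable def besselKernel (n : ℕ) (k : Fin n → ℤ) (t : ℝ) : ℝ :=
  Real.exp (-t) * ∏ j, realBesselI (k j) (t / n)

theorem besselKernel_eq_mul_prod_erase {n : ℕ} (k k' : Fin n → ℤ) (t : ℝ) (j : Fin n)
    (h : ∀ i ≠ j, k' i = k i) :
    besselKernel n k' t =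
      Real.exp (-t) * ((∏ i ∈ Finset.univ.erase j, realBesselI (k i) (t / n)) *
        realBesselI (k' j) (t / n)) := by
  rw [besselKernel, ← Finset.prod_erase_mul _ _ (Finset.mem_univ j)]
  congr 2
  exact Finset.prod_congr rfl fun i hi => by rw [h i (Finset.ne_of_mem_erase hi)]

theorem hasDerivAt_besselKernel {n : ℕ} (hn : 0 < n) (k : Fin n → ℤ) (t : ℝ) :
    HasDerivAt (besselKernel n k) (latticeLaplacian n (fun y => besselKernel n y t) k) t := by
  have h := (hasDerivAt_neg t).exp.mul (HasDerivAt.fun_finsetProd (u := Finset.univ)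
    fun j _ => (hasDerivAt_realBesselI (k j) (t / n)).comp t ((hasDerivAt_id t).div_const (n : ℝ)))
  refine h.congr_deriv ?_
  rw [latticeLaplacian_eq hn, Finset.mul_sum, Finset.mul_sum, sub_eq_neg_add]
  congr 1
  · simp [besselKernel]
  · refine Finset.sum_congr rfl fun j _ => ?_
    rw [besselKernel_eq_mul_prod_erase k (k + Pi.single j 1) t j fun i hi => by simp [hi],
      besselKernel_eq_mul_prod_erase k (k - Pi.single j 1) t j fun i hi => by simp [hi]]
    simp only [Function.comp, id, smul_eq_mul, Pi.add_apply, Pi.sub_apply, Pi.single_eq_same]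
    field_simp

theorem besselKernel_zero (n : ℕ) (k : Fin n → ℤ) :
    besselKernel n k 0 = (Pi.single 0 1 : (Fin n → ℤ) → ℝ) k := by
  simp only [besselKernel, neg_zero, Real.exp_zero, zero_div, realBesselI_zero, one_mul]
  by_cases hk : k = 0
  · subst hk
    simp
  · obtain ⟨j, hj⟩ := Function.ne_iff.1 hk
    rw [Pi.single_eq_of_ne hk]
    exact Finset.prod_eq_zero (Finset.mem_univ j) (if_neg hj)

theorem besselKernel_isBoundedSol {n : ℕ} (hn : 0 < n) : IsBoundedSol n (besselKernel n) := by
  refine ⟨1, fun k t ht => ?_⟩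
  have hn' : (n : ℝ) ≠ 0 := by positivity
  rw [besselKernel, abs_mul, Finset.abs_prod, abs_of_pos (Real.exp_pos _), Real.exp_neg]
  refine inv_mul_le_one_of_le₀ ?_ (Real.exp_pos _).le
  calc ∏ j, |realBesselI (k j) (t / n)| ≤ ∏ _j : Fin n, Real.exp (t / n) :=
        Finset.prod_le_prod (fun _ _ => abs_nonneg _)
          fun j _ => abs_realBesselI_le _ (by positivity)
    _ = Real.exp t := by
        rw [Finset.prod_const, Finset.card_univ, Fintype.card_fin, ← Real.exp_nat_mul]
        congr 1
        field_simp

theorem lpConv_single {G : Type*} [AddGroup G] [DecidableEq G]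
    (hM : ∀ k : G, |(Pi.single 0 1 : G → ℝ) k| ≤ 1) (k : G) (f : lp (fun _ : G => ℝ) 1) :
    lpConv (Pi.single 0 1) 1 hM k f = f k := by
  rw [lpConv_apply, tsum_eq_single k]
  · simp
  · intro l hl
    rw [Pi.single_eq_of_ne (sub_ne_zero.2 hl.symm), zero_mul]

theorem heatFlow_apply {n : ℕ} (hn : 0 < n) (k : Fin n → ℤ) {t : ℝ} (ht : 0 ≤ t) :
    heatFlow n t k = besselKernel n k t := by
  have hM (k : Fin n → ℤ) : |(Pi.single 0 1 : (Fin n → ℤ) → ℝ) k| ≤ 1 := by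
    rw [Pi.single_apply]
    split_ifs <;> simp
  rw [← lpConv_single hM]
  exact IsLatticeHeatSolution.unique hn (lpConv_heatFlow_isBoundedSol n _ 1 hM)
    (lpConv_heatFlow_isLatticeHeatSolution hn _ 1 hM) (besselKernel_isBoundedSol hn)
    (isLatticeHeatSolution_of_hasDerivAt (hasDerivAt_besselKernel hn) (besselKernel_zero n)) k ht

/-- Theorem 5.2 of the paper: for a lattice `Λ = ℤ^n B` (`B ∈ GL_n(ℝ)`)
and bounded `u0 : Λ → ℝ`, the heat equation `∂_t u = Δ_Λ u` with `u(⋅,0) = u0` has a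
unique bounded solution, differentiable in `t > 0` and continuous in `t ≥ 0`, given by
`u(x,t) = Σ_{y∈Λ} u0(x−y) K_{Λ,t}(y)` with
`K_{Λ,t}(y) = e^{−t} ∏_j I_{(yB⁻¹)_j}(t/n)`; here points of `Λ` are written as `kB`,
`k ∈ ℤ^n`, so that `y = lB` and `(yB⁻¹)_j = ((lB)B⁻¹)_j`. -/
theorem heat_equation_on_lattice (n : ℕ) (hn : 0 < n)
    (B : Matrix (Fin n) (Fin n) ℝ) (hB : IsUnit B.det)
    (u0 : (Fin n → ℤ) → ℝ) (hu0 : ∃ M : ℝ, ∀ k, |u0 k| ≤ M) :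
    ∃ u : (Fin n → ℤ) → ℝ → ℝ,
      (IsBoundedSol n u ∧ IsLatticeHeatSolution n u0 u) ∧
      (∀ v : (Fin n → ℤ) → ℝ → ℝ,
        IsBoundedSol n v ∧ IsLatticeHeatSolution n u0 v →
        ∀ k t, 0 ≤ t → v k t = u k t) ∧
      (∀ (k : Fin n → ℤ) (t : ℝ), 0 ≤ t →
        (u k t : ℂ) = ∑' l : Fin n → ℤ, (u0 (k - l) : ℂ) *
          (Complex.exp (-(t : ℂ)) *
            ∏ j, besselI ((((fun i => (l i : ℝ)) ᵥ* B) ᵥ* B⁻¹) j) (((t / n : ℝ)) : ℂ))) := by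
  obtain ⟨M, hM⟩ := hu0
  refine ⟨fun k t => lpConv u0 M hM k (heatFlow n t),
    ⟨lpConv_heatFlow_isBoundedSol n u0 M hM, lpConv_heatFlow_isLatticeHeatSolution hn u0 M hM⟩,
    fun v hv k t ht => ?_, fun k t ht => ?_⟩
  · exact IsLatticeHeatSolution.unique hn hv.1 hv.2 (lpConv_heatFlow_isBoundedSol n u0 M hM)
      (lpConv_heatFlow_isLatticeHeatSolution hn u0 M hM) k ht
  · beta_reduce
    rw [lpConv_apply, Complex.ofReal_tsum]
    refine tsum_congr fun l => ?_
    rw [heatFlow_apply hn l ht, Matrix.vecMul_vecMul, Matrix.mul_nonsing_inv B hB,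
      Matrix.vecMul_one]
    simp only [besselI_intCast, besselKernel]
    push_cast
    rfl
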